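/- Let k : Fin 3 → Fin 3 → ZMod d be a game matrix whose entries are all zero except k(1,2) = x, k(2,1) = y, and k(2,2) = z (rows and columns indexed 0,1,2), where x, y, z are all nonzero. Then β_C(k) = 2 if y = z, or x = z, or z = x + y in ZMod d, and β_C(k) = 3 otherwise. -/

import Mathlib

/-- The number of contradictions of the classical strategy `(a, b)` for the game matrix `k`. -/
def numContr {nA nB d : ℕ} (k : Fin nA → Fin nB → ZMod d)
    (a : Fin nA → ZMod d) (b : Fin nB → ZMod d) : ℕ :=
  ((Finset.univ : Finset (Fin nA × Fin nB)).filter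
    (fun p => b p.2 ≠ a p.1 + k p.1 p.2)).card

/-- The contradiction number `β_C(k)`: the minimum number of contradictions over all
classical strategies. -/
noncomputable def betaC {nA nB d : ℕ} (k : Fin nA → Fin nB → ZMod d) : ℕ :=
  sInf { m | ∃ (a : Fin nA → ZMod d) (b : Fin nB → ZMod d), numContr k a b = m }

theorem betaC_le_numContr {nA nB d : ℕ} (k : Fin nA → Fin nB → ZMod d)
    (a : Fin nA → ZMod d) (b : Fin nB → ZMod d) : betaC k ≤ numContr k a b :=
  Nat.sInf_le ⟨a, b, rfl⟩

theorem le_betaC {nA nB d m : ℕ} {k : Fin nA → Fin nB → ZMod d}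
    (h : ∀ a b, m ≤ numContr k a b) : m ≤ betaC k := by
  refine le_csInf ⟨_, 0, 0, rfl⟩ ?_
  rintro _ ⟨a, b, rfl⟩
  exact h a b

theorem numContr_eq_sum {nA nB d : ℕ} (k : Fin nA → Fin nB → ZMod d)
    (a : Fin nA → ZMod d) (b : Fin nB → ZMod d) :
    numContr k a b = ∑ i, ∑ j, if b j ≠ a i + k i j then 1 else 0 := by
  rw [numContr, Finset.card_filter, Fintype.sum_prod_type]

/-- A strategy has a contradiction on every inconsistent four-cycle. -/
theorem one_le_contr_of_cycle {nA nB d : ℕ} (k : Fin nA → Fin nB → ZMod d)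
    (a : Fin nA → ZMod d) (b : Fin nB → ZMod d) (i i' : Fin nA) (j j' : Fin nB)
    (h : k i j + k i' j' ≠ k i j' + k i' j) :
    1 ≤ (if b j ≠ a i + k i j then 1 else 0) + (if b j' ≠ a i + k i j' then 1 else 0) +
      (if b j ≠ a i' + k i' j then 1 else 0) + (if b j' ≠ a i' + k i' j' then 1 else 0) := by
  by_contra hlt
  have h₁ : b j = a i + k i j := by by_contra hne; simp [hne] at hlt
  have h₂ : b j' = a i + k i j' := by by_contra hne; simp [hne] at hlt
  have h₃ : b j = a i' + k i' j := by by_contra hne; simp [hne] at hlt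
  have h₄ : b j' = a i' + k i' j' := by by_contra hne; simp [hne] at hlt
  exact h (by linear_combination h₂ + h₃ - h₁ - h₄)

/-- For a `3 × 3` game matrix with all entries zero except `k(1,2) = x`, `k(2,1) = y`,
`k(2,2) = z` (all nonzero): `β_C = 2` if `y = z`, `x = z`, or `z = x + y`, and `β_C = 3`
otherwise. -/
theorem betaC_three_entries_3x3 {d : ℕ} (hd : 1 ≤ d) (k : Fin 3 → Fin 3 → ZMod d)
    (x y z : ZMod d) (hx : x ≠ 0) (hy : y ≠ 0) (hz : z ≠ 0)
    (h12 : k 1 2 = x) (h21 : k 2 1 = y) (h22 : k 2 2 = z)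
    (hzero : ∀ i j : Fin 3,
      ¬ ((i, j) = ((1 : Fin 3), (2 : Fin 3)) ∨ (i, j) = ((2 : Fin 3), (1 : Fin 3)) ∨
        (i, j) = ((2 : Fin 3), (2 : Fin 3))) → k i j = 0) :
    ((y = z ∨ x = z ∨ z = x + y) → betaC k = 2) ∧
    (¬ (y = z ∨ x = z ∨ z = x + y) → betaC k = 3) := by
  have h00 : k 0 0 = 0 := hzero 0 0 (by decide)
  have h01 : k 0 1 = 0 := hzero 0 1 (by decide)
  have h02 : k 0 2 = 0 := hzero 0 2 (by decide)
  have h10 : k 1 0 = 0 := hzero 1 0 (by decide)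
  have h11 : k 1 1 = 0 := hzero 1 1 (by decide)
  have h20 : k 2 0 = 0 := hzero 2 0 (by decide)
  constructor
  · intro hxyz
    apply le_antisymm
    · rcases hxyz with rfl | rfl | rfl
      · refine (betaC_le_numContr k ![0, 0, -y] ![0, 0, 0]).trans ?_
        simp [numContr_eq_sum, Fin.sum_univ_three, hx.symm, *]
      · refine (betaC_le_numContr k ![0, 0, 0] ![0, 0, x]).trans ?_
        simp [numContr_eq_sum, Fin.sum_univ_three, hy.symm, *]
      · refine (betaC_le_numContr k ![0, 0, -y] ![0, 0, x]).trans ?_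
        simp [numContr_eq_sum, Fin.sum_univ_three, *]
    · refine le_betaC fun a b => ?_
      have c₁ := one_le_contr_of_cycle k a b 0 1 0 2 (by simp [*])
      have c₂ := one_le_contr_of_cycle k a b 0 2 0 1 (by simp [*])
      have c₃ := one_le_contr_of_cycle k a b 0 1 1 2 (by simp [*])
      simp only [numContr_eq_sum, Fin.sum_univ_three]
      omega
  · intro hxyz
    push Not at hxyz
    obtain ⟨hyz, hxz, hxyz⟩ := hxyz
    apply le_antisymm
    · refine (betaC_le_numContr k 0 0).trans ?_
      simp [numContr_eq_sum, Fin.sum_univ_three, hx.symm, hy.symm, hz.symm, *]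
    · refine le_betaC fun a b => ?_
      have c₁ := one_le_contr_of_cycle k a b 0 1 0 2 (by simp [*])
      have c₂ := one_le_contr_of_cycle k a b 0 1 1 2 (by simp [*])
      have c₃ := one_le_contr_of_cycle k a b 0 2 0 1 (by simp [*])
      have c₄ := one_le_contr_of_cycle k a b 1 2 0 1 (by simp [*])
      have c₅ := one_le_contr_of_cycle k a b 0 2 0 2 (by simp [*])
      have c₆ := one_le_contr_of_cycle k a b 1 2 1 2 (by simp [*])
      have c₇ := one_le_contr_of_cycle k a b 1 2 0 2 (by simp [*, Ne.symm hxz])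
      have c₈ := one_le_contr_of_cycle k a b 0 2 1 2 (by simp [*, Ne.symm hyz])
      simp only [numContr_eq_sum, Fin.sum_univ_three]
      omega
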